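/- For every NPLCS N, location q and set of locations A ⊆ Q, the following are equivalent: (i) A is reachable from (q,ε) in the lossy transition system; (ii) there exists a scheduler U with Pr_U((q,ε) ⊨ ◇A) > 0; (iii) there exists a memoryless scheduler U with Pr_U((q,ε) ⊨ ◇A) > 0. -/

import Mathlib

open scoped ENNReal
open Classical

namespace NPLCSmodel

/-! ## Lossy channel systems -/

/-- Operations of a lossy channel system: send a message on a channel,
receive a message from a channel, or an internal action. -/
inductive LcsOp (C M : Type) : Type where
  | send : C → M → LcsOp C M
  | recv : C → M → LcsOp C M
  | internal : LcsOp C M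

def LcsOp.IsRecv {C M : Type} : LcsOp C M → Prop
  | .recv _ _ => True
  | _ => False

/-- A transition rule `src --op--> dst`. -/
structure LcsRule (Q C M : Type) : Type where
  src : Q
  op : LcsOp C M
  dst : Q

/-- Channel contents: a word over `M` for each channel. -/
abbrev Chans (C M : Type) : Type := C → List M

/-- Configurations: a location together with channel contents. -/
abbrev Conf (Q C M : Type) : Type := Q × Chans C M

/-- The empty channel contents ε. -/
def eps (C M : Type) : Chans C M := fun _ => []

variable {Q C M : Type}

/-- When is an operation possible on channel contents `w`? -/
def enabledOp : LcsOp C M → Chans C M → Prop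
  | .recv c m, w => ∃ v, w c = m :: v
  | .send _ _, _ => True
  | .internal, _ => True

/-- Effect of an operation on the channel contents (for a perfect step). -/
def applyOp [DecidableEq C] : LcsOp C M → Chans C M → Chans C M
  | .send c m, w => Function.update w c (w c ++ [m])
  | .recv c _, w => Function.update w c (w c).tail
  | .internal, w => w

/-- A rule is enabled in a configuration. -/
def LcsRule.EnabledIn (δ : LcsRule Q C M) (s : Conf Q C M) : Prop :=
  δ.src = s.1 ∧ enabledOp δ.op s.2

/-- A lossy channel system `L = (Q, C, M, Δ)` (the finiteness of the location,
channel and message types is imposed by `Fintype` assumptions at use sites):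
a finite set of transition rules such that every location has at least one
outgoing rule that is not a receive. -/
structure LCS (Q C M : Type) : Type where
  rules : Set (LcsRule Q C M)
  finiteRules : rules.Finite
  noDeadlock : ∀ q : Q, ∃ δ ∈ rules, δ.src = q ∧ ¬ δ.op.IsRecv

variable [DecidableEq C]

/-- Lossy step via rule `δ`: a perfect step followed by losing arbitrarily
many messages (`<+` is the (componentwise) subword relation). -/
def LCS.StepVia (L : LCS Q C M) (s : Conf Q C M) (δ : LcsRule Q C M)
    (t : Conf Q C M) : Prop :=
  δ ∈ L.rules ∧ δ.EnabledIn s ∧ t.1 = δ.dst ∧ ∀ c, List.Sublist (t.2 c) (applyOp δ.op s.2 c)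

/-- Lossy step `s → t`. -/
def LCS.Step (L : LCS Q C M) (s t : Conf Q C M) : Prop := ∃ δ, L.StepVia s δ t

/-- Reachability `s →* t`. -/
def LCS.Reach (L : LCS Q C M) : Conf Q C M → Conf Q C M → Prop :=
  Relation.ReflTransGen L.Step

/-- Constrained reachability `s →*_[X) t`: all configurations along the path,
except possibly the last one, have their location in `X`. -/
def LCS.ReachWithin (L : LCS Q C M) (X : Set Q) : Conf Q C M → Conf Q C M → Prop :=
  Relation.ReflTransGen (fun a b => L.Step a b ∧ a.1 ∈ X)

/-- Constrained reachability `s →*_[X] t`: all configurations along the path,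
including `s` and `t`, have their location in `X`. -/
def LCS.ReachConstrained (L : LCS Q C M) (X : Set Q) (s t : Conf Q C M) : Prop :=
  L.ReachWithin X s t ∧ t.1 ∈ X

/-- `X` is safe for `A`. -/
def LCS.IsSafeFor (L : LCS Q C M) (A X : Set Q) : Prop :=
  X ⊆ A ∧ ∀ x ∈ X, ∃ t, L.Step (x, eps C M) t ∧ t.1 ∈ X

/-- `Safe(A)`: the largest set safe for `A` (the union of all such sets). -/
def LCS.Safe (L : LCS Q C M) (A : Set Q) : Set Q := ⋃₀ {X | L.IsSafeFor A X}

/-- `X` is promising for `A`. -/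
def LCS.IsPromisingFor (L : LCS Q C M) (A X : Set Q) : Prop :=
  ∀ x ∈ X, ∃ t, L.ReachWithin X (x, eps C M) t ∧ t.1 ∈ A

/-- `Prom(A)`: the largest set promising for `A` (the union of all such sets). -/
def LCS.Prom (L : LCS Q C M) (A : Set Q) : Set Q := ⋃₀ {X | L.IsPromisingFor A X}

/-! ## NPLCS and the induced Markov decision process -/

/-- An NPLCS: an LCS together with a fault rate `τ ∈ (0,1)`. -/
structure NPLCS (Q C M : Type) : Type where
  L : LCS Q C M
  τ : ℝ
  τ_pos : 0 < τ
  τ_lt_one : τ < 1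

/-- The number of embeddings of the second list as a subword of the first. -/
def countEmb [DecidableEq M] : List M → List M → ℕ
  | _, [] => 1
  | [], _ :: _ => 0
  | a :: v, b :: w => (if a = b then countEmb v w else 0) + countEmb v (b :: w)

variable [Fintype C] [DecidableEq M]

/-- Total number of messages in the channels. -/
def chansSize (w : Chans C M) : ℕ := ∑ c, (w c).length

/-- `P_lost(v,v') = τ^(|v|-|v'|) · (1-τ)^|v'| · C(v,v')`, the probability that
channel contents `v` become `v'` through message losses. -/
noncomputable def plost (τ : ℝ) (v v' : Chans C M) : ℝ≥0∞ :=
  ENNReal.ofReal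
    (τ ^ (chansSize v - chansSize v') * (1 - τ) ^ chansSize v' *
      (∏ c, countEmb (v c) (v' c) : ℕ))

/-- One-step probability `P_N(s, δ, t)` of the MDP of an NPLCS. -/
noncomputable def NPLCS.stepProb (N : NPLCS Q C M) (s : Conf Q C M)
    (δ : LcsRule Q C M) (t : Conf Q C M) : ℝ≥0∞ :=
  if δ ∈ N.L.rules ∧ δ.EnabledIn s ∧ t.1 = δ.dst then
    plost N.τ (applyOp δ.op s.2) t.2
  else 0

/-! ## Probability measure of a countable-state Markov chain

Given one-step probabilities `k` on a state space `S`, the measure of a set of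
trajectories is the Carathéodory outer measure generated by the probabilities
of cylinder sets; it agrees with the usual Markov-chain measure on all
measurable (in particular, on all ω-regular) sets of trajectories. -/

section Chain
variable {S : Type}

/-- Probability that the chain starting in `s` performs the finite sequence
of steps through the configurations listed in `l`. -/
noncomputable def chainPathProb (k : S → S → ℝ≥0∞) : S → List S → ℝ≥0∞
  | _, [] => 1
  | s, t :: l => k s t * chainPathProb k t l

/-- The cylinder of trajectories starting with `s` followed by `l`. -/
def chainCyl (s : S) (l : List S) : Set (ℕ → S) :=
  {ω | ω 0 = s ∧ ∀ (i : ℕ) (h : i < l.length), ω (i + 1) = l.get ⟨i, h⟩}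

/-- Premeasure: probability of a cylinder set, `∞` on other (nonempty) sets. -/
noncomputable def chainFun (k : S → S → ℝ≥0∞) (s : S) (A : Set (ℕ → S)) : ℝ≥0∞ :=
  if A = ∅ then 0 else ⨅ (l : List S) (_ : A = chainCyl s l), chainPathProb k s l

theorem chainFun_empty (k : S → S → ℝ≥0∞) (s : S) : chainFun k s ∅ = 0 := by
  simp [chainFun]

/-- The probability, for the Markov chain with one-step probabilities `k`
started in `s`, of the set `E` of trajectories (paths starting in `s`). -/
noncomputable def chainPr (k : S → S → ℝ≥0∞) (s : S) (E : Set (ℕ → S)) : ℝ≥0∞ :=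
  MeasureTheory.OuterMeasure.ofFunction (chainFun k s) (chainFun_empty k s)
    (E ∩ {ω | ω 0 = s})

end Chain

/-! ## Schedulers -/

/-- A (history-dependent, deterministic) scheduler: given the history
`h = s₁ → ⋯ → s_{n-1}` and the current configuration `sₙ`, it chooses a
transition rule of `N` enabled in `sₙ`. -/
structure Scheduler (N : NPLCS Q C M) : Type where
  choose : List (Conf Q C M) → Conf Q C M → LcsRule Q C M
  choose_mem : ∀ h s, choose h s ∈ N.L.rules
  choose_enabled : ∀ h s, (choose h s).EnabledIn s

variable {N : NPLCS Q C M}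

/-- The Markov chain `MC_U` induced by a scheduler: its states are finite
paths, represented as (history, current configuration). -/
noncomputable def Scheduler.kernel (U : Scheduler N) :
    List (Conf Q C M) × Conf Q C M → List (Conf Q C M) × Conf Q C M → ℝ≥0∞ :=
  fun a b =>
    if b.1 = a.1 ++ [a.2] then N.stepProb a.2 (U.choose a.1 a.2) b.2 else 0

/-- `Pr_U(s ⊨ E)`: the probability, under scheduler `U` with starting
configuration `s`, of the set `E` of infinite paths (trajectories of
configurations). -/
noncomputable def Scheduler.Pr (U : Scheduler N) (s : Conf Q C M)
    (E : Set (ℕ → Conf Q C M)) : ℝ≥0∞ :=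
  chainPr U.kernel ([], s) {ω | (fun i => (ω i).2) ∈ E}

/-- Memoryless scheduler: the decision depends only on the current
configuration. -/
def Scheduler.Memoryless (U : Scheduler N) : Prop :=
  ∀ h h' s, U.choose h s = U.choose h' s

/-- Blind scheduler: the decision depends only on the sequence of locations
that have been visited. -/
def Scheduler.Blind (U : Scheduler N) : Prop :=
  ∀ h h' s s', h.map Prod.fst = h'.map Prod.fst → s.1 = s'.1 →
    U.choose h s = U.choose h' s'

/-- Finite-memory scheduler data: finitely many modes, a starting mode, a
decision rule and a next-mode function. -/
structure FMScheduler (N : NPLCS Q C M) : Type 1 where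
  Mode : Type
  modeFin : Fintype Mode
  init : Mode
  D : Mode → Conf Q C M → LcsRule Q C M
  upd : Mode → Conf Q C M → Mode
  D_mem : ∀ u s, D u s ∈ N.L.rules
  D_enabled : ∀ u s, (D u s).EnabledIn s

/-- A scheduler is finite-memory if it is induced by finite-memory data. -/
def Scheduler.FiniteMemory (U : Scheduler N) : Prop :=
  ∃ fm : FMScheduler N, ∀ h s, U.choose h s = fm.D (h.foldl fm.upd fm.init) s

/-- The Markov chain `MC_U` of a finite-memory scheduler: states are pairs
`s_u` of a configuration `s` and a mode `u`. -/
noncomputable def FMScheduler.kernel (fm : FMScheduler N) :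
    Conf Q C M × fm.Mode → Conf Q C M × fm.Mode → ℝ≥0∞ :=
  fun a b =>
    if b.2 = fm.upd a.2 a.1 then N.stepProb a.1 (fm.D a.2 a.1) b.1 else 0

/-- Probability measure of the Markov chain `MC_U` of a finite-memory
scheduler, over trajectories of (configuration, mode) states. -/
noncomputable def FMScheduler.PrMC (fm : FMScheduler N)
    (a : Conf Q C M × fm.Mode) (E : Set (ℕ → Conf Q C M × fm.Mode)) : ℝ≥0∞ :=
  chainPr fm.kernel a E

/-- Reachability in the Markov chain `MC_U` of a finite-memory scheduler. -/
def FMScheduler.MCReach (fm : FMScheduler N) :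
    Conf Q C M × fm.Mode → Conf Q C M × fm.Mode → Prop :=
  Relation.ReflTransGen (fun a b => 0 < fm.kernel a b)

/-- The history (the first `i` configurations) of a trajectory. -/
def histTo (ω : ℕ → Conf Q C M) (i : ℕ) : List (Conf Q C M) :=
  (List.range i).map ω

/-- Almost blind scheduler: there are a scheduler `W` and a blind scheduler
`V` such that from any starting configuration, almost surely the choices of
`U` along the path agree with those of `W` up to some finite time and with
those of `V` afterwards. -/
def Scheduler.AlmostBlind (U : Scheduler N) : Prop :=
  ∃ W V : Scheduler N, V.Blind ∧ ∀ s : Conf Q C M,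
    U.Pr s {ω | ∃ n : ℕ,
      (∀ i ≤ n, U.choose (histTo ω i) (ω i) = W.choose (histTo ω i) (ω i)) ∧
      (∀ i, n < i → U.choose (histTo ω i) (ω i) = V.choose (histTo ω i) (ω i))} = 1

/-! ## LTL-style events on trajectories -/

/-- `□P` -/
def evAlways {α : Type} (P : α → Prop) : Set (ℕ → α) := {ω | ∀ i, P (ω i)}

/-- `◇P` -/
def evEventually {α : Type} (P : α → Prop) : Set (ℕ → α) := {ω | ∃ i, P (ω i)}

/-- `□◇P` -/
def evInfOften {α : Type} (P : α → Prop) : Set (ℕ → α) :=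
  {ω | ∀ n, ∃ i, n ≤ i ∧ P (ω i)}

/-- `◇□P` -/
def evEvAlways {α : Type} (P : α → Prop) : Set (ℕ → α) :=
  {ω | ∃ n, ∀ i, n ≤ i → P (ω i)}

/-- The atomic proposition "the current location belongs to `A`". -/
def inLoc (A : Set Q) : Conf Q C M → Prop := fun s => s.1 ∈ A


section ChainMeasure

open MeasureTheory ProbabilityTheory Preorder

theorem chainPathProb_eq_prod {S : Type} (k : S → S → ℝ≥0∞) (s : S) (l : List S) :
    chainPathProb k s l =
      ∏ i ∈ Finset.range l.length, k ((s :: l).getD i s) ((s :: l).getD (i + 1) s) := by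
  induction l generalizing s with
  | nil => simp [chainPathProb]
  | cons t l ih =>
    rw [chainPathProb, ih, List.length_cons, Finset.prod_range_succ']
    rw [mul_comm]
    congr 1
    refine Finset.prod_congr rfl fun i hi => ?_
    have hi' : i < l.length := Finset.mem_range.1 hi
    have h1 : i < (t :: l).length := by simp; omega
    have h2 : i + 1 < (t :: l).length := by simpa using hi'
    simp only [List.getD_cons_succ]
    rw [List.getD_eq_getElem _ _ h1, List.getD_eq_getElem _ _ h1,
      List.getD_eq_getElem _ _ hi', List.getD_eq_getElem _ _ hi']

theorem chainCyl_eq_preimage {S : Type} (s : S) (l : List S) :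
    chainCyl s l = (frestrictLe (π := fun _ => S) l.length) ⁻¹'
      {frestrictLe l.length fun i => (s :: l).getD i s} := by
  ext ω
  simp only [chainCyl, Set.mem_ofPred_eq, Set.mem_preimage, Set.mem_singleton_iff]
  constructor
  · rintro ⟨h0, h⟩
    funext ⟨i, hi⟩
    have hi' : i ≤ l.length := Finset.mem_Iic.1 hi
    simp only [frestrictLe_apply]
    cases i with
    | zero => simpa using h0
    | succ i =>
      rw [h i hi', List.getD_cons_succ, List.getD_eq_getElem _ _ hi', List.get_eq_getElem]
  · intro h
    have h' : ∀ i ≤ l.length, ω i = (s :: l).getD i s := fun i hi => by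
      simpa using congrFun h ⟨i, Finset.mem_Iic.2 hi⟩
    refine ⟨by simpa using h' 0 (Nat.zero_le _), fun i hi => ?_⟩
    rw [h' _ hi, List.getD_cons_succ, List.getD_eq_getElem _ _ hi, List.get_eq_getElem]

/-- The one-step kernel, as a kernel depending on the trajectory up to time `n`. -/
noncomputable def stepKernel {S : Type} [MeasurableSpace S] (κ : Kernel S S) (n : ℕ) :
    Kernel (Π _ : Finset.Iic n, S) S :=
  κ.comap (fun x => x ⟨n, Finset.mem_Iic.2 le_rfl⟩) (measurable_pi_apply _)

instance {S : Type} [MeasurableSpace S] (κ : Kernel S S) [IsMarkovKernel κ] (n : ℕ) :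
    IsMarkovKernel (stepKernel κ n) := by
  unfold stepKernel; infer_instance

theorem partialTraj_stepKernel_singleton {S : Type} [MeasurableSpace S]
    [MeasurableSingletonClass S] (κ : Kernel S S) [IsMarkovKernel κ] (ω : ℕ → S) (n : ℕ) :
    Kernel.partialTraj (X := fun _ => S) (stepKernel κ) 0 n (frestrictLe 0 ω) {frestrictLe n ω} =
      ∏ i ∈ Finset.range n, κ (ω i) {ω (i + 1)} := by
  induction n with
  | zero => simp [Kernel.partialTraj_self, Kernel.id_apply]
  | succ n ih =>
    have key : ∀ y : Π _ : Finset.Iic n, S,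
        Kernel.partialTraj (X := fun _ => S) (stepKernel κ) n (n + 1) y {frestrictLe (n + 1) ω} =
          ({frestrictLe n ω} : Set _).indicator (fun _ => κ (ω n) {ω (n + 1)}) y := by
      intro y
      rw [Kernel.partialTraj_succ_self,
        Kernel.map_apply' _ (measurable_IicProdIoc (X := fun _ => S)) _ (measurableSet_singleton _)]
      have hpre : (IicProdIoc (X := fun _ => S) n (n + 1)) ⁻¹' {frestrictLe (n + 1) ω} =
          {frestrictLe n ω} ×ˢ {fun _ => ω (n + 1)} := by
        ext ⟨a, b⟩
        simp only [Set.mem_preimage, Set.mem_singleton_iff, Set.mem_prod]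
        constructor
        · intro h
          constructor
          · funext ⟨i, hi⟩
            have hi' : i ≤ n := Finset.mem_Iic.1 hi
            have := congrFun h ⟨i, Finset.mem_Iic.2 (by omega)⟩
            simpa [IicProdIoc, hi'] using this
          · funext ⟨i, hi⟩
            have hi' := Finset.mem_Ioc.1 hi
            obtain rfl : i = n + 1 := by omega
            have := congrFun h ⟨n + 1, Finset.mem_Iic.2 le_rfl⟩
            simpa [IicProdIoc] using this
        · rintro ⟨rfl, rfl⟩
          funext ⟨i, hi⟩
          have hi' : i ≤ n + 1 := Finset.mem_Iic.1 hi
          by_cases h : i ≤ n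
          · simp [IicProdIoc, h]
          · obtain rfl : i = n + 1 := by omega
            simp [IicProdIoc]
      rw [hpre, Kernel.prod_apply, Measure.prod_prod, Kernel.id_apply,
        Measure.dirac_apply' _ (measurableSet_singleton _),
        Kernel.map_apply' _ (by fun_prop) _ (measurableSet_singleton _)]
      by_cases hy : y = frestrictLe n ω
      · subst hy
        have : (MeasurableEquiv.piSingleton (X := fun _ => S) n) ⁻¹' {fun _ => ω (n + 1)} =
            {ω (n + 1)} := by
          ext t
          simp only [Set.mem_preimage, Set.mem_singleton_iff]
          constructor
          · intro h
            simpa [MeasurableEquiv.piSingleton] using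
              congrFun h ⟨n + 1, Finset.mem_Ioc.2 ⟨by omega, le_rfl⟩⟩
          · rintro rfl
            funext ⟨i, hi⟩
            have hi' := Finset.mem_Ioc.1 hi
            obtain rfl : i = n + 1 := by omega
            simp [MeasurableEquiv.piSingleton]
        rw [this]
        simp [stepKernel, Kernel.comap_apply]
      · simp [hy]
    rw [Kernel.partialTraj_succ_eq_comp (Nat.zero_le n),
      Kernel.comp_apply' _ _ _ (measurableSet_singleton _)]
    simp_rw [key]
    rw [lintegral_indicator_const (measurableSet_singleton _), ih, Finset.prod_range_succ, mul_comm]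

/-- For a stochastic matrix on a countable state space, an event containing a cylinder is at
least as likely as that cylinder. -/
theorem chainPathProb_le_chainPr {S : Type} [Countable S] (k : S → S → ℝ≥0∞)
    (hk : ∀ s, ∑' t, k s t = 1) {s : S} {l : List S} {E : Set (ℕ → S)}
    (hE : chainCyl s l ⊆ E) : chainPathProb k s l ≤ chainPr k s E := by
  let _ : MeasurableSpace S := ⊤
  have hsc : MeasurableSingletonClass S := ⟨fun _ => trivial⟩
  let p : S → PMF S := fun s => ⟨k s, hk s ▸ ENNReal.summable.hasSum⟩
  let κ : Kernel S S := ⟨fun s => (p s).toMeasure, measurable_from_top⟩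
  have hκ : IsMarkovKernel κ := ⟨fun s => inferInstanceAs (IsProbabilityMeasure (p s).toMeasure)⟩
  have hκk : ∀ s t, κ s {t} = k s t := fun s t =>
    (p s).toMeasure_apply_singleton t (measurableSet_singleton t)
  let μ := Kernel.traj (X := fun _ => S) (stepKernel κ) 0 (fun _ => s)
  have hcyl : ∀ l, μ (chainCyl s l) = chainPathProb k s l := fun l => by
    rw [chainCyl_eq_preimage, ← Measure.map_apply (measurable_frestrictLe _)
      (measurableSet_singleton _), Kernel.traj_map_frestrictLe_apply, chainPathProb_eq_prod]
    have h0 : (fun _ => s : Π _ : Finset.Iic 0, S) =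
        frestrictLe (π := fun _ => S) 0 (fun i => (s :: l).getD i s) := by
      funext ⟨i, hi⟩
      obtain rfl : i = 0 := by simpa using hi
      simp
    rw [h0, partialTraj_stepKernel_singleton]
    simp only [hκk]
  have hle : μ.toOuterMeasure ≤
      OuterMeasure.ofFunction (chainFun k s) (chainFun_empty k s) := by
    rw [OuterMeasure.le_ofFunction]
    intro B
    unfold chainFun
    split_ifs with hB
    · simp [hB]
    · refine le_iInf₂ fun l hl => ?_
      rw [hl]
      exact (hcyl l).le
  calc chainPathProb k s l = μ (chainCyl s l) := (hcyl l).symm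
    _ ≤ μ (E ∩ {ω | ω 0 = s}) := measure_mono fun ω hω => ⟨hE hω, hω.1⟩
    _ ≤ _ := hle _

/-- If `P` is eventually reached with positive probability, then some path of positive
probability ends in a state satisfying `P`. -/
theorem exists_chainPathProb_pos {S : Type} [Countable S] (k : S → S → ℝ≥0∞) {s : S} {P : S → Prop}
    (h : 0 < chainPr k s (evEventually P)) :
    ∃ l, 0 < chainPathProb k s l ∧ P ((s :: l).getLast (List.cons_ne_nil _ _)) := by
  by_contra! hne
  refine h.ne' (le_antisymm ?_ bot_le)
  let G : Set (List S) := {l | P ((s :: l).getLast (List.cons_ne_nil _ _))}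
  have hsub : evEventually P ∩ {ω | ω 0 = s} ⊆ ⋃ l ∈ G, chainCyl s l := by
    rintro ω ⟨⟨i, hi⟩, h0 : ω 0 = s⟩
    have hlast : (s :: (List.range i).map fun j => ω (j + 1)).getLast (List.cons_ne_nil _ _)
        = ω i := by
      cases i with
      | zero => simp [h0]
      | succ i => simp [List.range_succ]
    refine Set.mem_biUnion (show ((List.range i).map fun j => ω (j + 1)) ∈ G from ?_) ⟨h0, ?_⟩
    · simp only [G, Set.mem_ofPred_eq]
      rwa [hlast]
    · intro j hj
      simp
  refine (measure_mono hsub).trans ((measure_biUnion_le _ (Set.to_countable G) _).trans ?_)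
  rw [nonpos_iff_eq_zero, ENNReal.tsum_eq_zero]
  rintro ⟨l, hl⟩
  refine le_antisymm ((OuterMeasure.ofFunction_le _).trans ?_) bot_le
  unfold chainFun
  split_ifs with hB
  · exact le_rfl
  · refine iInf₂_le_of_le l rfl ?_
    by_contra hpos
    exact hne l (not_le.1 hpos) hl

end ChainMeasure

section Loss

theorem countEmb_pos_iff {M : Type} [DecidableEq M] (v w : List M) :
    0 < countEmb v w ↔ w.Sublist v := by
  induction v generalizing w with
  | nil => cases w <;> simp [countEmb]
  | cons a v ih =>
    cases w with
    | nil => simp [countEmb]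
    | cons b w =>
      rw [countEmb, Nat.add_pos_iff_pos_or_pos, ih, List.sublist_cons_iff, or_comm]
      split_ifs with h
      · simp [ih, h]
      · simp [Ne.symm h]

theorem countEmb_eq_zero {M : Type} [DecidableEq M] {v w : List M} (h : ¬ w.Sublist v) :
    countEmb v w = 0 := by
  rw [← countEmb_pos_iff] at h
  omega

/-- The probability that the word `v` on a single channel becomes `w`. -/
noncomputable def wordLost {M : Type} [DecidableEq M] (τ : ℝ) (v w : List M) : ℝ≥0∞ :=
  ENNReal.ofReal (τ ^ (v.length - w.length) * (1 - τ) ^ w.length * countEmb v w)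

theorem wordLost_cons_nil {M : Type} [DecidableEq M] {τ : ℝ} (h0 : 0 < τ) (a : M) (v : List M) :
    wordLost τ (a :: v) [] = ENNReal.ofReal τ * wordLost τ v [] := by
  have hv : countEmb v [] = 1 := by cases v <;> simp [countEmb]
  rw [wordLost, wordLost, ← ENNReal.ofReal_mul h0.le, hv]
  simp [countEmb, pow_succ']

theorem wordLost_cons_cons {M : Type} [DecidableEq M] {τ : ℝ} (h0 : 0 < τ) (h1 : τ < 1)
    (a b : M) (v w : List M) :
    wordLost τ (a :: v) (b :: w) = ENNReal.ofReal τ * wordLost τ v (b :: w) +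
      ENNReal.ofReal (1 - τ) * (if a = b then wordLost τ v w else 0) := by
  have h2 : 0 < 1 - τ := sub_pos.2 h1
  have hif : (if a = b then wordLost τ v w else 0) =
      ENNReal.ofReal (if a = b then τ ^ (v.length - w.length) * (1 - τ) ^ w.length *
        countEmb v w else 0) := by
    split_ifs <;> simp [wordLost]
  rw [hif, wordLost, wordLost, ← ENNReal.ofReal_mul h0.le, ← ENNReal.ofReal_mul h2.le,
    ← ENNReal.ofReal_add (by positivity) (by split_ifs <;> positivity)]
  congr 1
  simp only [countEmb, List.length_cons, Nat.add_sub_add_right]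
  by_cases hlen : w.length + 1 ≤ v.length
  · obtain ⟨d, hd⟩ := Nat.exists_eq_add_of_le hlen
    rw [show v.length - w.length = d + 1 by omega, show v.length - (w.length + 1) = d by omega]
    split_ifs <;> push_cast <;> ring
  · rw [countEmb_eq_zero (w := b :: w) fun h => hlen (by simpa using h.length_le)]
    split_ifs <;> push_cast <;> ring

theorem tsum_wordLost {M : Type} [DecidableEq M] {τ : ℝ} (h0 : 0 < τ) (h1 : τ < 1) (v : List M) :
    ∑' w, wordLost τ v w = 1 := by
  induction v with
  | nil =>
    rw [tsum_eq_single []]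
    · simp [wordLost, countEmb]
    · rintro (_ | ⟨b, w⟩) h
      · exact absurd rfl h
      · simp [wordLost, countEmb]
  | cons a v ih =>
    let g : List M → ℝ≥0∞ := fun w => match w with
      | [] => 0
      | b :: w => if a = b then wordLost τ v w else 0
    have hg : ∑' w, g w = 1 := by
      rw [← ih, ← (List.cons_injective (a := a)).tsum_eq (f := g)]
      · simp [g]
      · rintro (_ | ⟨b, w⟩) h
        · exact absurd rfl h
        · by_cases hab : a = b
          · exact ⟨w, by rw [hab]⟩
          · exact absurd (if_neg hab) h
    have hsplit : ∀ w, wordLost τ (a :: v) w =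
        ENNReal.ofReal τ * wordLost τ v w + ENNReal.ofReal (1 - τ) * g w := by
      rintro (_ | ⟨b, w⟩)
      · simp [g, wordLost_cons_nil h0]
      · exact wordLost_cons_cons h0 h1 a b v w
    simp_rw [hsplit]
    rw [ENNReal.tsum_add, ENNReal.tsum_mul_left, ENNReal.tsum_mul_left, ih, hg, mul_one, mul_one,
      ← ENNReal.ofReal_add h0.le (sub_pos.2 h1).le]
    simp

theorem plost_eq_prod {C M : Type} [Fintype C] [DecidableEq M] {τ : ℝ} (h0 : 0 < τ) (h1 : τ < 1)
    (v w : Chans C M) : plost τ v w = ∏ c, wordLost τ (v c) (w c) := by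
  have h2 : 0 < 1 - τ := sub_pos.2 h1
  unfold wordLost plost
  rw [← ENNReal.ofReal_prod_of_nonneg fun c _ => by positivity]
  congr 1
  by_cases h : ∀ c, (w c).Sublist (v c)
  · rw [Finset.prod_mul_distrib, Finset.prod_mul_distrib, Finset.prod_pow_eq_pow_sum,
      Finset.prod_pow_eq_pow_sum, Finset.sum_tsub_distrib _ fun c _ => (h c).length_le]
    push_cast [chansSize]
    rfl
  · push Not at h
    obtain ⟨c, hc⟩ := h
    have hz := countEmb_eq_zero hc
    have hz' : ∏ c, countEmb (v c) (w c) = 0 := Finset.prod_eq_zero (Finset.mem_univ c) hz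
    rw [hz', Finset.prod_eq_zero (Finset.mem_univ c) (by simp [hz])]
    simp

theorem tsum_pi_prod_eq_one {C β : Type} [Fintype C] [Countable β] (f : C → β → ℝ≥0∞)
    (hf : ∀ c, ∑' b, f c b = 1) : ∑' w : C → β, ∏ c, f c (w c) = 1 := by
  let _ : MeasurableSpace β := ⊤
  have hsc : MeasurableSingletonClass β := ⟨fun _ => trivial⟩
  let p : C → PMF β := fun c => ⟨f c, hf c ▸ ENNReal.summable.hasSum⟩
  let μ := MeasureTheory.Measure.pi fun c => (p c).toMeasure
  have hμ : ∀ w, μ {w} = ∏ c, f c (w c) := fun w => by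
    rw [MeasureTheory.Measure.pi_singleton]
    exact Finset.prod_congr rfl fun c _ =>
      (p c).toMeasure_apply_singleton (w c) (measurableSet_singleton _)
  have := MeasureTheory.Measure.tsum_indicator_apply_singleton μ Set.univ MeasurableSet.univ
  simpa [hμ] using this

theorem tsum_plost {C M : Type} [Fintype C] [Fintype M] [DecidableEq M] {τ : ℝ}
    (h0 : 0 < τ) (h1 : τ < 1) (v : Chans C M) : ∑' w, plost τ v w = 1 := by
  simp_rw [plost_eq_prod h0 h1]
  exact tsum_pi_prod_eq_one _ fun c => tsum_wordLost h0 h1 (v c)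

theorem plost_pos_iff {C M : Type} [Fintype C] [DecidableEq M] {τ : ℝ}
    (h0 : 0 < τ) (h1 : τ < 1) (v w : Chans C M) :
    0 < plost τ v w ↔ ∀ c, (w c).Sublist (v c) := by
  have h2 : 0 < 1 - τ := sub_pos.2 h1
  rw [plost, ENNReal.ofReal_pos, mul_pos_iff_of_pos_left (by positivity), Nat.cast_pos,
    CanonicallyOrderedAdd.prod_pos]
  simp [countEmb_pos_iff]

end Loss

section Reachability

theorem stepProb_pos_iff {Q C M : Type} [DecidableEq C] [Fintype C] [DecidableEq M]
    (N : NPLCS Q C M) (s : Conf Q C M) (δ : LcsRule Q C M) (t : Conf Q C M) :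
    0 < N.stepProb s δ t ↔ N.L.StepVia s δ t := by
  unfold NPLCS.stepProb LCS.StepVia
  split_ifs with h
  · rw [plost_pos_iff N.τ_pos N.τ_lt_one]
    tauto
  · simp only [lt_self_iff_false, false_iff]
    tauto

theorem Scheduler.tsum_kernel {Q C M : Type} [DecidableEq C] [Fintype C] [Fintype M]
    [DecidableEq M] {N : NPLCS Q C M} (U : Scheduler N) (a : List (Conf Q C M) × Conf Q C M) :
    ∑' b, U.kernel a b = 1 := by
  let δ := U.choose a.1 a.2
  let e : Chans C M → List (Conf Q C M) × Conf Q C M := fun w => (a.1 ++ [a.2], (δ.dst, w))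
  have he : Function.Injective e := fun w w' h => by simpa [e] using h
  rw [← tsum_plost N.τ_pos N.τ_lt_one (applyOp δ.op a.2.2), ← he.tsum_eq]
  · refine tsum_congr fun w => ?_
    have hδ : δ ∈ N.L.rules ∧ δ.EnabledIn a.2 ∧ δ.dst = δ.dst :=
      ⟨U.choose_mem _ _, U.choose_enabled _ _, rfl⟩
    simp only [Scheduler.kernel, e, if_true, NPLCS.stepProb]
    exact if_pos hδ
  · rintro ⟨h, t, w⟩ hb
    simp only [Function.mem_support, Scheduler.kernel, NPLCS.stepProb] at hb
    split_ifs at hb with h1 h2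
    · exact ⟨w, by simp only [e, h1, δ, ← h2.2.2]⟩
    all_goals exact absurd rfl hb

theorem Scheduler.kernel_pos_iff {Q C M : Type} [DecidableEq C] [Fintype C] [DecidableEq M]
    {N : NPLCS Q C M} (U : Scheduler N) (a b : List (Conf Q C M) × Conf Q C M) :
    0 < U.kernel a b ↔ b.1 = a.1 ++ [a.2] ∧ N.L.StepVia a.2 (U.choose a.1 a.2) b.2 := by
  unfold Scheduler.kernel
  split_ifs with h
  · simp [stepProb_pos_iff, h]
  · simp [h]

theorem Scheduler.reach_of_chainPathProb_pos {Q C M : Type} [DecidableEq C] [Fintype C]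
    [DecidableEq M] {N : NPLCS Q C M} (U : Scheduler N) (a : List (Conf Q C M) × Conf Q C M)
    (l : List (List (Conf Q C M) × Conf Q C M)) (h : 0 < chainPathProb U.kernel a l) :
    N.L.Reach a.2 ((a :: l).getLast (List.cons_ne_nil _ _)).2 := by
  induction l generalizing a with
  | nil => exact Relation.ReflTransGen.refl
  | cons b l ih =>
    rw [chainPathProb, CanonicallyOrderedAdd.mul_pos, U.kernel_pos_iff] at h
    rw [List.getLast_cons (List.cons_ne_nil _ _)]
    exact (ih b h.2).head ⟨_, h.1.2⟩

/-- `A` can be reached from the configuration in exactly `n` lossy steps. -/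
def ReachIn {Q C M : Type} [DecidableEq C] (L : LCS Q C M) (A : Set Q) : ℕ → Conf Q C M → Prop
  | 0, s => s.1 ∈ A
  | n + 1, s => ∃ t, L.Step s t ∧ ReachIn L A n t

theorem exists_reachIn_of_reach {Q C M : Type} [DecidableEq C] {L : LCS Q C M} {A : Set Q}
    {s t : Conf Q C M} (h : L.Reach s t) (ht : t.1 ∈ A) : ∃ n, ReachIn L A n s := by
  induction h using Relation.ReflTransGen.head_induction_on with
  | refl => exact ⟨0, ht⟩
  | head hstep _ ih => exact ih.imp' (· + 1) fun n hn => ⟨_, hstep, hn⟩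

theorem exists_enabled_rule {Q C M : Type} (L : LCS Q C M) (s : Conf Q C M) :
    ∃ δ ∈ L.rules, δ.EnabledIn s := by
  obtain ⟨δ, hδ, hsrc, hop⟩ := L.noDeadlock s.1
  refine ⟨δ, hδ, hsrc, ?_⟩
  cases hδop : δ.op <;> simp_all [LcsOp.IsRecv, enabledOp]

/-- A rule is progressing towards `A` in `s` if it can lead to a configuration from which `A` can
be reached in fewer steps than it takes from `s`. -/
def Progressing {Q C M : Type} [DecidableEq C] (L : LCS Q C M) (A : Set Q) (s : Conf Q C M)
    (δ : LcsRule Q C M) : Prop :=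
  ∃ t, L.StepVia s δ t ∧ ∃ n, ReachIn L A n t ∧ ∀ m ≤ n, ¬ ReachIn L A m s

theorem exists_preferred_rule {Q C M : Type} [DecidableEq C] (L : LCS Q C M) (A : Set Q)
    (s : Conf Q C M) : ∃ δ, (δ ∈ L.rules ∧ δ.EnabledIn s) ∧
      ((∃ δ', Progressing L A s δ') → Progressing L A s δ) := by
  by_cases h : ∃ δ', Progressing L A s δ'
  · obtain ⟨δ, hδ⟩ := h
    obtain ⟨t, ht, -⟩ := id hδ
    exact ⟨δ, ⟨ht.1, ht.2.1⟩, fun _ => hδ⟩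
  · obtain ⟨δ, h1, h2⟩ := exists_enabled_rule L s
    exact ⟨δ, ⟨h1, h2⟩, fun h' => absurd h' h⟩

/-- A memoryless scheduler that picks a progressing rule whenever there is one. -/
noncomputable def progressScheduler {Q C M : Type} [DecidableEq C] (N : NPLCS Q C M)
    (A : Set Q) : Scheduler N where
  choose _ s := (exists_preferred_rule N.L A s).choose
  choose_mem _ s := (exists_preferred_rule N.L A s).choose_spec.1.1
  choose_enabled _ s := (exists_preferred_rule N.L A s).choose_spec.1.2

theorem progressScheduler_exists_path {Q C M : Type} [DecidableEq C] [Fintype C] [DecidableEq M]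
    (N : NPLCS Q C M) (A : Set Q) (n : ℕ) (a : List (Conf Q C M) × Conf Q C M)
    (hn : ReachIn N.L A n a.2) : ∃ l, 0 < chainPathProb (progressScheduler N A).kernel a l ∧
      ((a :: l).getLast (List.cons_ne_nil _ _)).2.1 ∈ A := by
  induction n using Nat.strong_induction_on generalizing a with
  | _ n ih =>
    by_cases hmin : ∃ m < n, ReachIn N.L A m a.2
    · obtain ⟨m, hm, hma⟩ := hmin
      exact ih m hm a hma
    · cases n with
      | zero => exact ⟨[], by simp [chainPathProb], hn⟩
      | succ n =>
        push Not at hmin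
        obtain ⟨t, ⟨δ, hδ⟩, ht⟩ := hn
        obtain ⟨t, hstep, m, hm, hmin'⟩ := (exists_preferred_rule N.L A a.2).choose_spec.2
          ⟨δ, t, hδ, n, ht, fun m hm => hmin m (Nat.lt_succ_of_le hm)⟩
        have hmn : m < n + 1 := by
          by_contra hlt
          exact hmin' (n + 1) (not_lt.1 hlt) ⟨_, ⟨δ, hδ⟩, ht⟩
        obtain ⟨l, hl, hlast⟩ := ih m hmn (a.1 ++ [a.2], t) hm
        refine ⟨(a.1 ++ [a.2], t) :: l, ?_, ?_⟩
        · rw [chainPathProb, CanonicallyOrderedAdd.mul_pos, Scheduler.kernel_pos_iff]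
          exact ⟨⟨rfl, hstep⟩, hl⟩
        · rwa [List.getLast_cons (List.cons_ne_nil _ _)]

theorem chainCyl_subset_evEventually {S : Type} (P : S → Prop) {s : S} {l : List S}
    (h : P ((s :: l).getLast (List.cons_ne_nil _ _))) : chainCyl s l ⊆ evEventually P := by
  rintro ω ⟨h0, hl⟩
  refine ⟨l.length, ?_⟩
  rcases List.eq_nil_or_concat l with rfl | ⟨l, t, rfl⟩
  · simpa [h0] using h
  · have := hl l.length (by simp)
    simp_all

theorem Scheduler.Pr_evEventually_pos_iff {Q C M : Type} [Fintype Q] [Fintype C] [DecidableEq C]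
    [Fintype M] [DecidableEq M] {N : NPLCS Q C M} (U : Scheduler N) (s : Conf Q C M) (A : Set Q) :
    0 < U.Pr s (evEventually (inLoc A)) ↔ ∃ l, 0 < chainPathProb U.kernel ([], s) l ∧
      ((([], s) :: l).getLast (List.cons_ne_nil _ _)).2.1 ∈ A := by
  let P : List (Conf Q C M) × Conf Q C M → Prop := fun b => b.2.1 ∈ A
  refine ⟨fun h => exists_chainPathProb_pos (P := P) U.kernel h, fun ⟨l, hl, hA⟩ => ?_⟩
  exact hl.trans_le
    (chainPathProb_le_chainPr _ U.tsum_kernel (chainCyl_subset_evEventually P hA))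

end Reachability

/-- Reachability of `A` from `(q,ε)` is equivalent to `◇A` holding with
positive probability under some scheduler, and also under some memoryless
scheduler. -/
theorem statement6 {Q C M : Type} [Fintype Q] [Fintype C] [DecidableEq C]
    [Fintype M] [DecidableEq M] (N : NPLCS Q C M) (q : Q) (A : Set Q) :
    ((∃ t, N.L.Reach (q, eps C M) t ∧ t.1 ∈ A) ↔
      ∃ U : Scheduler N, 0 < U.Pr (q, eps C M) (evEventually (inLoc A)))
    ∧ ((∃ t, N.L.Reach (q, eps C M) t ∧ t.1 ∈ A) ↔
      ∃ U : Scheduler N, U.Memoryless ∧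
        0 < U.Pr (q, eps C M) (evEventually (inLoc A))) := by
  have reach_of_pos : ∀ U : Scheduler N, 0 < U.Pr (q, eps C M) (evEventually (inLoc A)) →
      ∃ t, N.L.Reach (q, eps C M) t ∧ t.1 ∈ A := fun U hU =>
    let ⟨l, hl, hA⟩ := (U.Pr_evEventually_pos_iff _ A).1 hU
    ⟨_, U.reach_of_chainPathProb_pos _ l hl, hA⟩
  have pos_of_reach : (∃ t, N.L.Reach (q, eps C M) t ∧ t.1 ∈ A) →
      0 < (progressScheduler N A).Pr (q, eps C M) (evEventually (inLoc A)) := fun ⟨t, ht, hA⟩ =>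
    let ⟨n, hn⟩ := exists_reachIn_of_reach ht hA
    (Scheduler.Pr_evEventually_pos_iff _ _ A).2
      (progressScheduler_exists_path N A n ([], (q, eps C M)) hn)
  exact ⟨⟨fun h => ⟨_, pos_of_reach h⟩, fun ⟨U, hU⟩ => reach_of_pos U hU⟩,
    ⟨fun h => ⟨_, fun _ _ _ => rfl, pos_of_reach h⟩, fun ⟨U, _, hU⟩ => reach_of_pos U hU⟩⟩

end NPLCSmodel
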